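/- arXiv:hep-th/0503086 — 2 statements merged into one kernel-verified Lean document; each statement's English description precedes it below -/
import Mathlib

section
/- For every integer n ≥ 3, lim_{ρ→0⁺} F̃_n'(ρ) = 0, where F̃_n(ρ) = π n² ∫₀^∞ s^n / ((ρ²+s)² (1+s^n)²) ds; consequently the lifted metric F̃_n(ρ)(dρ² + ρ² dλ²) extends to a C¹ metric on S². -/
open MeasureTheory Real Set Filter Topology

/-- The integrand of `F̃ₙ`, without the prefactor `π n²`. -/
noncomputable def liftedIntegrand (n : ℕ) (ρ s : ℝ) : ℝ :=
  s ^ n / ((ρ^2 + s)^2 * (1 + s^n)^2)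

/-- The derivative of `liftedIntegrand n ρ s` in `ρ`. -/
noncomputable def liftedIntegrandDeriv (n : ℕ) (ρ s : ℝ) : ℝ :=
  -4 * ρ * (s ^ n / ((ρ^2 + s)^3 * (1 + s^n)^2))

lemma pow_div_one_add_pow_sq_le {m n : ℕ} (hmn : m + 2 ≤ 2 * n) {s : ℝ} (hs : 0 < s) :
    s ^ m / (1 + s ^ n) ^ 2 ≤ 2 * (1 + s ^ 2)⁻¹ := by
  rw [← div_eq_mul_inv, div_le_div_iff₀ (by positivity) (by positivity)]
  have hn : 0 < s ^ n := by positivity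
  rcases le_total s 1 with h | h
  · have h1 : s ^ m ≤ 1 := pow_le_one₀ hs.le h
    have h2 : s ^ 2 ≤ 1 := pow_le_one₀ hs.le h
    have h3 : s ^ m * (1 + s ^ 2) ≤ 1 * 2 := by gcongr; linarith
    nlinarith
  · have h1 : s ^ m ≤ s ^ (2 * n) := pow_le_pow_right₀ h (by omega)
    have h2 : s ^ (m + 2) ≤ s ^ (2 * n) := pow_le_pow_right₀ h hmn
    have h3 : s ^ (2 * n) = (s ^ n) ^ 2 := by rw [mul_comm, pow_mul]
    rw [pow_add] at h2
    nlinarith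

lemma pow_div_sq_add_pow_le {k n : ℕ} (hk : 2 ≤ k + n) (hkn : k ≤ n) (ρ : ℝ) {s : ℝ}
    (hs : 0 < s) :
    s ^ n / ((ρ ^ 2 + s) ^ k * (1 + s ^ n) ^ 2) ≤ 2 * (1 + s ^ 2)⁻¹ := by
  refine le_trans ?_ (pow_div_one_add_pow_sq_le (m := n - k) (n := n) (by omega) hs)
  calc s ^ n / ((ρ ^ 2 + s) ^ k * (1 + s ^ n) ^ 2)
      ≤ s ^ n / (s ^ k * (1 + s ^ n) ^ 2) := by
        gcongr
        nlinarith [sq_nonneg ρ]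
    _ = s ^ (n - k) / (1 + s ^ n) ^ 2 := by
        rw [← div_div, pow_sub₀ s hs.ne' hkn, div_eq_mul_inv (s ^ n)]

lemma abs_liftedIntegrandDeriv_le {n : ℕ} (hn : 3 ≤ n) (ρ : ℝ) {s : ℝ} (hs : 0 < s) :
    |liftedIntegrandDeriv n ρ s| ≤ 4 * |ρ| * (2 * (1 + s ^ 2)⁻¹) := by
  have h0 : 0 ≤ s ^ n / ((ρ ^ 2 + s) ^ 3 * (1 + s ^ n) ^ 2) := by positivity
  rw [liftedIntegrandDeriv, abs_mul, abs_mul, abs_of_nonneg h0]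
  norm_num only [abs_neg, abs_of_pos]
  gcongr
  exact pow_div_sq_add_pow_le (by omega) hn ρ hs

lemma hasDerivAt_liftedIntegrand (n : ℕ) (ρ : ℝ) {s : ℝ} (hs : 0 < s) :
    HasDerivAt (fun ρ => liftedIntegrand n ρ s) (liftedIntegrandDeriv n ρ s) ρ := by
  have hρ : ρ ^ 2 + s ≠ 0 := by positivity
  have hsn : 1 + s ^ n ≠ 0 := by positivity
  have h := ((((hasDerivAt_pow 2 ρ).add_const s).fun_pow 2).mul_const ((1 + s ^ n) ^ 2)).fun_inv
    (by positivity) |>.const_mul (s ^ n)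
  simp only [← div_eq_mul_inv] at h
  refine h.congr_deriv ?_
  rw [liftedIntegrandDeriv]
  field_simp
  norm_num
  ring

lemma integrableOn_two_mul_inv_one_add_sq :
    IntegrableOn (fun s : ℝ => 2 * (1 + s ^ 2)⁻¹) (Ioi 0) :=
  (integrable_inv_one_add_sq.const_mul 2).integrableOn

lemma integrableOn_liftedIntegrand {n : ℕ} (hn : 2 ≤ n) (ρ : ℝ) :
    IntegrableOn (liftedIntegrand n ρ) (Ioi 0) := by
  refine integrableOn_two_mul_inv_one_add_sq.mono' ?_ ?_
  · unfold liftedIntegrand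
    exact Measurable.aestronglyMeasurable (by fun_prop)
  · filter_upwards [ae_restrict_mem measurableSet_Ioi] with s (hs : 0 < s)
    have h0 : 0 ≤ liftedIntegrand n ρ s := by unfold liftedIntegrand; positivity
    rw [Real.norm_eq_abs, abs_of_nonneg h0]
    exact pow_div_sq_add_pow_le (by omega) hn ρ hs

lemma hasDerivAt_integral_liftedIntegrand {n : ℕ} (hn : 3 ≤ n) (ρ : ℝ) :
    HasDerivAt (fun ρ => ∫ s in Ioi (0:ℝ), liftedIntegrand n ρ s)
      (∫ s in Ioi (0:ℝ), liftedIntegrandDeriv n ρ s) ρ := by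
  refine (hasDerivAt_integral_of_dominated_loc_of_deriv_le
    (bound := fun s => 4 * (|ρ| + 1) * (2 * (1 + s ^ 2)⁻¹))
    (Metric.ball_mem_nhds ρ one_pos)
    (.of_forall fun x => (integrableOn_liftedIntegrand (by omega) x).aestronglyMeasurable)
    (integrableOn_liftedIntegrand (by omega) ρ) ?_ ?_
    (integrableOn_two_mul_inv_one_add_sq.const_mul _) ?_).2
  · unfold liftedIntegrandDeriv
    exact Measurable.aestronglyMeasurable (by fun_prop)
  · filter_upwards [ae_restrict_mem measurableSet_Ioi] with s (hs : 0 < s) x hx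
    refine (abs_liftedIntegrandDeriv_le hn x hs).trans ?_
    rw [Metric.mem_ball, Real.dist_eq] at hx
    have := abs_sub_abs_le_abs_sub x ρ
    gcongr
    linarith
  · filter_upwards [ae_restrict_mem measurableSet_Ioi] with s (hs : 0 < s) x _
    exact hasDerivAt_liftedIntegrand n x hs

lemma norm_integral_liftedIntegrandDeriv_le {n : ℕ} (hn : 3 ≤ n) (ρ : ℝ) :
    ‖∫ s in Ioi (0:ℝ), liftedIntegrandDeriv n ρ s‖ ≤
      4 * |ρ| * ∫ s in Ioi (0:ℝ), 2 * (1 + s ^ 2)⁻¹ := by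
  rw [← integral_const_mul]
  refine norm_integral_le_of_norm_le (integrableOn_two_mul_inv_one_add_sq.const_mul _) ?_
  filter_upwards [ae_restrict_mem measurableSet_Ioi] with s (hs : 0 < s)
  exact abs_liftedIntegrandDeriv_le hn ρ hs

/-- For every integer `n ≥ 3`, `lim_{ρ→0⁺} F̃ₙ'(ρ) = 0`, where
`F̃ₙ(ρ) = π n² ∫₀^∞ sⁿ / ((ρ²+s)² (1+sⁿ)²) ds`. -/
theorem Ftilde_deriv_limit_zero (n : ℕ) (hn : 3 ≤ n) (F : ℝ → ℝ)
    (hF : ∀ ρ : ℝ, F ρ = π * (n:ℝ)^2 * ∫ s in Ioi (0:ℝ),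
      s ^ n / ((ρ^2 + s)^2 * (1 + s^n)^2)) :
    Tendsto (fun ρ : ℝ => deriv F ρ) (𝓝[>] 0) (𝓝 0) := by
  have hderiv : deriv F = fun ρ =>
      π * (n:ℝ)^2 * ∫ s in Ioi (0:ℝ), liftedIntegrandDeriv n ρ s := by
    rw [show F = _ from funext hF]
    exact funext fun ρ => ((hasDerivAt_integral_liftedIntegrand hn ρ).const_mul _).deriv
  have hlim : Tendsto (fun ρ : ℝ => 4 * |ρ| * ∫ s in Ioi (0:ℝ), 2 * (1 + s ^ 2)⁻¹)
      (𝓝[>] 0) (𝓝 0) := by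
    refine tendsto_nhdsWithin_of_tendsto_nhds (Continuous.tendsto' (by fun_prop) _ _ ?_)
    simp
  rw [hderiv]
  simpa using (squeeze_zero_norm (norm_integral_liftedIntegrandDeriv_le hn) hlim).const_mul
    (π * (n:ℝ)^2)
end

section
/- For every integer n ≥ 2, lim_{ρ→∞} ρ F̃_n'(ρ) / (2 F̃_n(ρ)) = -2, where F̃_n(ρ) = π n² ∫₀^∞ s^n / ((ρ²+s)² (1+s^n)²) ds and F̃_n' is its derivative. -/
open MeasureTheory Real Set Filter Topology

lemma integrableOn_pow_div_one_add_pow_sq {n : ℕ} (hn : 2 ≤ n) :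
    IntegrableOn (fun s : ℝ => s ^ n / (1 + s ^ n) ^ 2) (Ioi 0) := by
  refine Integrable.mono' ((integrable_inv_one_add_sq.const_mul 2).integrableOn (s := Ioi 0))
    (Measurable.aestronglyMeasurable (by fun_prop)) ?_
  filter_upwards [ae_restrict_mem measurableSet_Ioi] with s (hs : 0 < s)
  have hp : 0 < s ^ n := by positivity
  have h2 : s ^ 2 ≤ 1 + s ^ n := by
    rcases le_total s 1 with h | h
    · nlinarith
    · linarith [pow_le_pow_right₀ h hn]
  rw [Real.norm_of_nonneg (by positivity), ← div_eq_mul_inv,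
    div_le_div_iff₀ (by positivity) (by positivity)]
  nlinarith [mul_le_mul_of_nonneg_left h2 hp.le]

lemma integral_pow_div_one_add_pow_sq_pos {n : ℕ} (hn : 2 ≤ n) :
    0 < ∫ s in Ioi (0 : ℝ), s ^ n / (1 + s ^ n) ^ 2 := by
  rw [setIntegral_pos_iff_support_of_nonneg_ae _ (integrableOn_pow_div_one_add_pow_sq hn)]
  · have h : Ioi (0 : ℝ) ⊆ Function.support (fun s : ℝ => s ^ n / (1 + s ^ n) ^ 2) := by
      intro s (hs : 0 < s)
      exact (show 0 < s ^ n / (1 + s ^ n) ^ 2 by positivity).ne'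
    rw [inter_eq_self_of_subset_right h]
    simp
  · filter_upwards [ae_restrict_mem measurableSet_Ioi] with s (hs : 0 < s)
    exact (show 0 < s ^ n / (1 + s ^ n) ^ 2 by positivity).le

lemma tendsto_pow_mul_integral_div_add_pow {g : ℝ → ℝ} (hg : IntegrableOn g (Ioi 0)) (k : ℕ) :
    Tendsto (fun t : ℝ => t ^ k * ∫ s in Ioi (0 : ℝ), g s / (t + s) ^ k) atTop
      (𝓝 (∫ s in Ioi (0 : ℝ), g s)) := by
  simp_rw [← integral_const_mul]
  refine tendsto_integral_filter_of_dominated_convergence (fun s => ‖g s‖) ?_ ?_ hg.norm ?_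
  · refine Eventually.of_forall fun t => AEStronglyMeasurable.const_mul ?_ _
    simp_rw [div_eq_mul_inv]
    exact hg.aestronglyMeasurable.mul (Measurable.aestronglyMeasurable (by fun_prop))
  · filter_upwards [eventually_gt_atTop 0] with t ht
    filter_upwards [ae_restrict_mem measurableSet_Ioi] with s (hs : 0 < s)
    have h : t ^ k * (g s / (t + s) ^ k) = g s * (t / (t + s)) ^ k := by
      rw [div_pow]; ring
    rw [h, norm_mul, Real.norm_of_nonneg (show 0 ≤ (t / (t + s)) ^ k by positivity)]
    refine mul_le_of_le_one_right (norm_nonneg _) (pow_le_one₀ (by positivity) ?_)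
    rw [div_le_one (by positivity)]
    linarith
  · filter_upwards with s
    have h : Tendsto (fun t : ℝ => t / (t + s)) atTop (𝓝 1) := by
      have h0 : Tendsto (fun t : ℝ => 1 - s / (t + s)) atTop (𝓝 (1 - 0)) :=
        tendsto_const_nhds.sub
          ((tendsto_atTop_add_const_right _ s tendsto_id).const_div_atTop s)
      rw [sub_zero] at h0
      refine h0.congr' ?_
      filter_upwards [eventually_gt_atTop (-s)] with t ht
      have : t + s ≠ 0 := by linarith
      field_simp
      ring
    have h1 := (h.pow k).const_mul (g s)
    rw [one_pow, mul_one] at h1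
    refine h1.congr fun t => ?_
    rw [div_pow]; ring

lemma hasDerivAt_integral_div_add_sq {g : ℝ → ℝ} (hg : IntegrableOn g (Ioi 0)) {t : ℝ}
    (ht : 0 < t) :
    HasDerivAt (fun t : ℝ => ∫ s in Ioi (0 : ℝ), g s / (t + s) ^ 2)
      (-2 * ∫ s in Ioi (0 : ℝ), g s / (t + s) ^ 3) t := by
  have hmeas (u : ℝ) (k : ℕ) : AEStronglyMeasurable (fun s => g s / (u + s) ^ k)
      (volume.restrict (Ioi 0)) := by
    simp_rw [div_eq_mul_inv]
    exact hg.aestronglyMeasurable.mul (Measurable.aestronglyMeasurable (by fun_prop))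
  have hbound {c u s : ℝ} (hc : 0 < c) (hu : c < u) (hs : 0 < s) (k : ℕ) :
      ‖g s / (u + s) ^ k‖ ≤ ‖g s‖ / c ^ k := by
    have hus : 0 < u + s := by linarith
    rw [norm_div, Real.norm_of_nonneg (show 0 ≤ (u + s) ^ k by positivity)]
    gcongr
    linarith
  rw [← integral_const_mul]
  refine (hasDerivAt_integral_of_dominated_loc_of_deriv_le
    (F' := fun u s => -2 * (g s / (u + s) ^ 3))
    (bound := fun s => 2 * (‖g s‖ / (t / 2) ^ 3))
    (Ioi_mem_nhds (half_lt_self ht)) (Eventually.of_forall fun u => hmeas u 2) ?_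
    ((hmeas t 3).const_mul (-2)) ?_ ((hg.norm.div_const _).const_mul 2) ?_).2
  · refine (hg.norm.div_const ((t / 2) ^ 2)).mono' (hmeas t 2) ?_
    filter_upwards [ae_restrict_mem measurableSet_Ioi] with s hs
    exact hbound (half_pos ht) (half_lt_self ht) hs 2
  · filter_upwards [ae_restrict_mem measurableSet_Ioi] with s hs u hu
    rw [norm_mul, norm_neg, Real.norm_ofNat]
    exact mul_le_mul_of_nonneg_left (hbound (half_pos ht) hu hs 3) zero_le_two
  · filter_upwards [ae_restrict_mem measurableSet_Ioi] with s (hs : 0 < s) u (hu : t / 2 < u)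
    have hne : u + s ≠ 0 := by linarith
    have h := (hasDerivAt_const u (g s)).div (((hasDerivAt_id u).add_const s).pow 2)
      (pow_ne_zero 2 hne)
    refine h.congr_deriv ?_
    simp only [id, Pi.pow_apply]
    field_simp
    ring

/-- For every integer `n ≥ 2`, `lim_{ρ→∞} ρ F̃ₙ'(ρ) / (2 F̃ₙ(ρ)) = -2`, where
`F̃ₙ(ρ) = π n² ∫₀^∞ sⁿ / ((ρ²+s)² (1+sⁿ)²) ds` and `F̃ₙ'` is its derivative. -/
theorem G_limit_at_infty (n : ℕ) (hn : 2 ≤ n) (F : ℝ → ℝ)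
    (hF : ∀ ρ : ℝ, F ρ = π * (n:ℝ)^2 * ∫ s in Ioi (0:ℝ),
      s ^ n / ((ρ^2 + s)^2 * (1 + s^n)^2)) :
    Tendsto (fun ρ : ℝ => ρ * deriv F ρ / (2 * F ρ)) atTop (𝓝 (-2)) := by
  set g : ℝ → ℝ := fun s => s ^ n / (1 + s ^ n) ^ 2 with hg_def
  have hg : IntegrableOn g (Ioi 0) := integrableOn_pow_div_one_add_pow_sq hn
  have hpos : 0 < ∫ s in Ioi (0 : ℝ), g s := integral_pow_div_one_add_pow_sq_pos hn
  set I : ℕ → ℝ → ℝ := fun k t => ∫ s in Ioi (0 : ℝ), g s / (t + s) ^ k with hI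
  have hFI : F = fun ρ => π * (n : ℝ) ^ 2 * I 2 (ρ ^ 2) := by
    funext ρ
    simp only [hF, hI, hg_def, div_div, mul_comm]
  have hsq : Tendsto (fun ρ : ℝ => ρ ^ 2) atTop atTop := tendsto_pow_atTop two_ne_zero
  have hlim := ((((tendsto_pow_mul_integral_div_add_pow hg 3).div
    (tendsto_pow_mul_integral_div_add_pow hg 2) hpos.ne').const_mul (-2)).comp hsq)
  rw [div_self hpos.ne', mul_one] at hlim
  refine hlim.congr' ?_
  filter_upwards [eventually_gt_atTop 0] with ρ hρ
  have hd : HasDerivAt F (π * (n : ℝ) ^ 2 * (-2 * I 3 (ρ ^ 2) * (2 * ρ))) ρ := by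
    rw [hFI]
    have h := HasDerivAt.comp (h := fun x : ℝ => x ^ 2) ρ
      (hasDerivAt_integral_div_add_sq hg (pow_pos hρ 2)) (hasDerivAt_pow 2 ρ)
    refine (h.const_mul (π * (n : ℝ) ^ 2)).congr_deriv ?_
    simp [hI]
  have hn0 : (n : ℝ) ≠ 0 := by positivity
  have hπ := pi_ne_zero
  rw [hd.deriv, hFI]
  change -2 * ((ρ ^ 2) ^ 3 * I 3 (ρ ^ 2) / ((ρ ^ 2) ^ 2 * I 2 (ρ ^ 2))) = _
  rcases eq_or_ne (I 2 (ρ ^ 2)) 0 with h0 | h0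
  · simp [h0]
  · field_simp
end
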